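/- arXiv:2108.02630 — 5 statements merged into one kernel-verified Lean document; each statement's English description precedes it below -/
import Mathlib

section
/- Let t and k be integers with k ≥ 4 and t ≥ k+1, and let G be a spanning subgraph of the complete bipartite graph K_{t,t} with bipartition (X,Y) containing a cycle C of length 2k. Let x ∈ X and y ∈ Y be vertices not on C with xy ∉ E(G). If each of x and y is adjacent in G to at least k−1 vertices of C, then G contains a cycle of length 2k+2. -/
open SimpleGraph Sum

/-- The complete bipartite graph `K_{t,t}` with both parts a copy of `Fin t`. -/
abbrev Kbb (t : ℕ) : SimpleGraph (Fin t ⊕ Fin t) := completeBipartiteGraph (Fin t) (Fin t)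

/-- `G` contains a cycle of length `m`. -/
def HasCycleLen {V : Type*} (G : SimpleGraph V) (m : ℕ) : Prop :=
  ∃ (v : V) (w : G.Walk v v), w.IsCycle ∧ w.length = m

/-- Every subgraph `G` of `K_{b,b}` contains a cycle of length `m`, or its bipartite
complement in `K_{b,b}` contains a cycle of length `n`. -/
def BRprop (m n b : ℕ) : Prop :=
  ∀ G : SimpleGraph (Fin b ⊕ Fin b), G ≤ Kbb b →
    HasCycleLen G m ∨ HasCycleLen (Kbb b \ G) n

/-- A cyclic sequence of `n ≥ 3` distinct, consecutively adjacent vertices gives a cycle of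
length `n`. -/
theorem hasCycleLen_of_injOn {V : Type*} {G : SimpleGraph V} {n : ℕ} (hn : 3 ≤ n) (f : ℕ → V)
    (hf : Set.InjOn f (Set.Iio n)) (hadj : ∀ m, m + 1 < n → G.Adj (f m) (f (m + 1)))
    (hclose : G.Adj (f (n - 1)) (f 0)) : HasCycleLen G n := by
  have key : ∀ u v : Fin n, (u - v).val = 1 → G.Adj (f v) (f u) := by
    intro u v h
    have hu := u.isLt
    have hv := v.isLt
    rcases le_or_gt v u with hvu | huv
    · rw [Fin.sub_val_of_le hvu] at h
      have : u.val = v.val + 1 := by omega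
      rw [this]
      exact hadj v (by omega)
    · rw [Fin.coe_sub_iff_lt.2 huv] at h
      have h0 : u.val = 0 := by omega
      have h1 : v.val = n - 1 := by omega
      rw [h0, h1]
      exact hclose
  refine (cycleGraph_isContained_iff hn).1 ⟨⟨⟨fun a => f a, ?_⟩, ?_⟩⟩
  · intro u v h
    rcases cycleGraph_adj'.1 h with h | h
    · exact (key u v h).symm
    · exact key v u h
  · intro u v h
    exact Fin.ext (hf u.isLt v.isLt h)

/-- Two new vertices `u`, `v` can be inserted in a path on `n` vertices so as to close it up to a
cycle, if `u` is adjacent to the last vertices, and `v` to the first vertices, of the two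
pieces of the path before and after position `p`. -/
theorem hasCycleLen_of_path_insert {V : Type*} {G : SimpleGraph V} {n p : ℕ} (hp : 0 < p)
    (hpn : p < n) (c : ℕ → V) (hc : Set.InjOn c (Set.Iio n))
    (hadj : ∀ m, m + 1 < n → G.Adj (c m) (c (m + 1))) {u v : V} (huv : u ≠ v)
    (hu : ∀ m < n, c m ≠ u) (hv : ∀ m < n, c m ≠ v)
    (hu₁ : G.Adj u (c (p - 1))) (hu₂ : G.Adj u (c (n - 1)))
    (hv₁ : G.Adj v (c 0)) (hv₂ : G.Adj v (c p)) : HasCycleLen G (n + 2) := by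
  let f : ℕ → V := fun m =>
    if m < p then c m else if m = p then u else if m ≤ n then c (n + p - m) else v
  refine hasCycleLen_of_injOn (by omega) f ?_ ?_ ?_
  · intro a ha b hb hab
    have hc' : ∀ i j, i < n → j < n → c i = c j → i = j := fun i j hi hj h => hc hi hj h
    simp only [Set.mem_Iio] at ha hb
    simp only [f] at hab
    split_ifs at hab <;> grind
  · intro m hm
    simp only [f]
    rcases lt_trichotomy (m + 1) p with h | h | h
    · simpa [h, show m < p by omega] using hadj m (by omega)
    · subst h
      simpa using hu₁.symm
    · rcases eq_or_ne m p with rfl | h'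
      · simpa [show m + 1 ≤ n by omega, show n + m - (m + 1) = n - 1 by omega] using hu₂
      · rcases eq_or_ne m n with rfl | h''
        · simpa [show ¬ m < p by omega, h', show m + 1 ≠ p by omega,
            show ¬ m + 1 < p by omega] using hv₂.symm
        · have := (hadj (n + p - (m + 1)) (by omega)).symm
          rw [show n + p - (m + 1) + 1 = n + p - m by omega] at this
          simpa [show ¬ m < p by omega, h', show m + 1 ≠ p by omega, show m ≤ n by omega,
            show ¬ m + 1 < p by omega, show m + 1 ≤ n by omega] using this
  · simpa [f, hp, show ¬ n + 1 < p by omega, show n + 1 ≠ p by omega] using hv₁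

/-- If `S` and `T` each miss at most one of at least four points, and `σ` is injective, then
two distinct points of `S` are mapped to `T` by `σ`. -/
theorem exists_ne_mem_and_map_mem {k : ℕ} (hk : 4 ≤ k) {S T : Set (Fin k)} {σ : Fin k → Fin k}
    (hσ : Function.Injective σ) (hS : k - 1 ≤ S.ncard) (hT : k - 1 ≤ T.ncard) :
    ∃ i j, i < j ∧ i ∈ S ∧ j ∈ S ∧ σ i ∈ T ∧ σ j ∈ T := by
  have hT' : (σ ⁻¹' T).ncard = T.ncard :=
    Set.ncard_preimage_of_injective_subset_range hσ
      (by simp [(Finite.injective_iff_surjective.1 hσ).range_eq])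
  have h₁ := Set.ncard_union_add_ncard_inter S (σ ⁻¹' T)
  have h₂ : (S ∪ σ ⁻¹' T).ncard ≤ k := by
    simpa using Set.ncard_le_ncard (Set.subset_univ (S ∪ σ ⁻¹' T))
  obtain ⟨a, ha, b, hb, hab⟩ := (Set.one_lt_ncard (s := S ∩ σ ⁻¹' T)).1 (by omega)
  rcases lt_or_gt_of_ne hab with h | h
  · exact ⟨a, b, h, ha.1, hb.1, ha.2, hb.2⟩
  · exact ⟨b, a, h, hb.1, ha.1, hb.2, ha.2⟩

/-- Lemma 2 (first case): if `G ⊆ K_{t,t}` (`k ≥ 4`, `t ≥ k+1`) has a `2k`-cycle and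
`x ∈ X`, `y ∈ Y` are off the cycle with `xy ∉ E(G)`, each adjacent to at least `k-1`
vertices of the cycle, then `G` has a cycle of length `2k + 2`. -/
theorem stmt2 (t k : ℕ) (hk : 4 ≤ k) (ht : k + 1 ≤ t)
    (G : SimpleGraph (Fin t ⊕ Fin t)) (hG : G ≤ Kbb t)
    (xs ys : Fin k → Fin t) (hxs : Function.Injective xs) (hys : Function.Injective ys)
    (hC : ∀ j : Fin k,
      G.Adj (inl (xs j)) (inr (ys j)) ∧
      G.Adj (inr (ys j)) (inl (xs ⟨(j.val + 1) % k, Nat.mod_lt _ (by omega)⟩)))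
    (x y : Fin t) (hx : x ∉ Set.range xs) (hy : y ∉ Set.range ys)
    (hxyE : ¬ G.Adj (inl x) (inr y))
    (hdx : k - 1 ≤ {j : Fin k | G.Adj (inl x) (inr (ys j))}.ncard)
    (hdy : k - 1 ≤ {j : Fin k | G.Adj (inl (xs j)) (inr y)}.ncard) :
    HasCycleLen G (2 * k + 2) := by
  have hk0 : 0 < k := by omega
  let r : ℕ → Fin k := fun n => ⟨n % k, Nat.mod_lt _ hk0⟩
  have hrr : ∀ a m n, m < k → n < k → r (a + m) = r (a + n) → m = n := by
    intro a m n hm hn h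
    have h : a + m ≡ a + n [MOD k] := Fin.ext_iff.1 h
    exact (Nat.ModEq.add_left_cancel' a h).eq_of_lt_of_lt hm hn
  have hr : ∀ j : Fin k, r j = j := fun j => Fin.ext (Nat.mod_eq_of_lt j.isLt)
  have hstep : ∀ n, r ((r n).val + 1) = r (n + 1) := fun n => Fin.ext (Nat.mod_add_mod _ _ _)
  have hσ : Function.Injective fun j : Fin k => r (j.val + 1) := by
    intro i j h
    refine Fin.ext (hrr 1 i j i.isLt j.isLt ?_)
    simpa only [add_comm] using h
  obtain ⟨i, j, hij, hi, hj, hi', hj'⟩ := exists_ne_mem_and_map_mem hk hσ hdx hdy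
  have hij : i.val < j.val := hij
  have hjk := j.isLt
  have h₁ : ∀ n, G.Adj (inl (xs (r n))) (inr (ys (r n))) := fun n => (hC (r n)).1
  have h₂ : ∀ n, G.Adj (inr (ys (r n))) (inl (xs (r (n + 1)))) := by
    intro n
    rw [← hstep n]
    exact (hC (r n)).2
  let c : ℕ → Fin t ⊕ Fin t := fun m =>
    if m % 2 = 0 then inl (xs (r (i + 1 + m / 2))) else inr (ys (r (i + 1 + m / 2)))
  refine hasCycleLen_of_path_insert (n := 2 * k) (p := 2 * (j - i)) (u := inl x) (v := inr y)
    (by omega) (by omega) c ?_ ?_ (by simp) ?_ ?_ ?_ ?_ ?_ ?_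
  · intro a ha b hb hab
    simp only [Set.mem_Iio] at ha hb
    simp only [c] at hab
    split_ifs at hab with hae hbe hbe
    · have := hrr _ _ _ (by omega) (by omega) (hxs (inl.inj hab))
      omega
    · have := hrr _ _ _ (by omega) (by omega) (hys (inr.inj hab))
      omega
  · intro m _
    rcases Nat.mod_two_eq_zero_or_one m with hm | hm
    · simpa [c, hm, show (m + 1) % 2 = 1 by omega, show (m + 1) / 2 = m / 2 by omega] using
        h₁ (i + 1 + m / 2)
    · simpa [c, hm, show (m + 1) % 2 = 0 by omega, show (m + 1) / 2 = m / 2 + 1 by omega,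
        add_assoc] using
        h₂ (i + 1 + m / 2)
  · intro m _ h
    simp only [c] at h
    split_ifs at h
    exact hx ⟨_, inl.inj h⟩
  · intro m _ h
    simp only [c] at h
    split_ifs at h
    exact hy ⟨_, inr.inj h⟩
  · have : i.val + 1 + (2 * (j.val - i.val) - 1) / 2 = j.val := by omega
    simp only [c, this, hr, show (2 * (j.val - i.val) - 1) % 2 ≠ 0 by omega, if_false]
    exact hj
  · have : r (i.val + 1 + (2 * k - 1) / 2) = i := by
      rw [show i.val + 1 + (2 * k - 1) / 2 = i.val + k by omega, ← hr i]
      exact Fin.ext (by simp [r])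
    simp only [c, this, show (2 * k - 1) % 2 ≠ 0 by omega, if_false]
    exact hi
  · exact hi'.symm
  · have : i.val + 1 + 2 * (j.val - i.val) / 2 = j.val + 1 := by omega
    simp only [c, this, show 2 * (j.val - i.val) % 2 = 0 by omega, if_true]
    exact hj'.symm
end

section
/- Let G be a subgraph of the complete bipartite graph K_{8,8} that contains a copy of the complete bipartite graph K_{3,4} (with the part of size 3 contained in one side of the bipartition and the part of size 4 in the other). Then either G contains a cycle C_8 of length 8, or the bipartite complement of G in K_{8,8} contains a cycle C_8 of length 8. -/
open SimpleGraph Sum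

/-- The relation `E`, seen as a bipartite graph, contains a cycle of length `8`. -/
def HasEightCycle {α β : Type*} (E : α → β → Prop) : Prop :=
  ∃ (r : Fin 4 → α) (c : Fin 4 → β), Function.Injective r ∧ Function.Injective c ∧
    ∀ i, E (r i) (c i) ∧ E (r i) (c (i + 1))

theorem HasEightCycle.of_flip {α β : Type*} {E : α → β → Prop}
    (h : HasEightCycle fun y x => E x y) : HasEightCycle E := by
  obtain ⟨r, c, hr, hc, h⟩ := h
  refine ⟨fun i => c (-i), fun i => r (-i), hc.comp neg_injective, hr.comp neg_injective,
    fun i => ⟨(h (-i)).1, ?_⟩⟩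
  have := (h (-(i + 1))).2
  rwa [neg_add, neg_add_cancel_right, ← neg_add] at this

/-- A complete `3 × 4` block together with a further row having two entries in the columns of the
block contains a cycle of length `8`. -/
theorem hasEightCycle_of_block {α β : Type*} [DecidableEq β] {E : α → β → Prop}
    {R : Finset α} {C : Finset β} (hR : R.card = 3) (hC : 4 ≤ C.card)
    (hE : ∀ x ∈ R, ∀ y ∈ C, E x y) {x : α} (hx : x ∉ R) {y z : β} (hy : y ∈ C) (hz : z ∈ C)
    (hyz : y ≠ z) (hxy : E x y) (hxz : E x z) : HasEightCycle E := by
  classical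
  obtain ⟨a, b, c, hab, hac, hbc, rfl⟩ := Finset.card_eq_three.1 hR
  have hcard : 1 < ((C.erase y).erase z).card := by
    rw [Finset.card_erase_of_mem (by simp [hz, hyz.symm]), Finset.card_erase_of_mem hy]
    omega
  obtain ⟨u, hu, v, hv, huv⟩ := Finset.one_lt_card.1 hcard
  simp only [Finset.mem_erase, Finset.mem_insert, Finset.mem_singleton, not_or] at hu hv hx hE
  refine ⟨![x, a, b, c], ![y, z, u, v], ?_, ?_, ?_⟩
  · intro i j
    fin_cases i <;> fin_cases j <;> simp <;> grind
  · intro i j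
    fin_cases i <;> fin_cases j <;> simp <;> grind
  · intro i
    fin_cases i <;> simp <;> grind

/-- In a `4 × 4` block in which every row and every column misses at most one entry there is a cycle
of length `8`. -/
theorem hasEightCycle_of_missing_matching {α β : Type*} {E : α → β → Prop}
    {R : Finset α} {C : Finset β} (hR : R.card = 4) (hC : C.card = 4)
    (hrow : ∀ x ∈ R, ∀ y ∈ C, ∀ z ∈ C, ¬ E x y → ¬ E x z → y = z)
    (hcol : ∀ y ∈ C, ∀ x ∈ R, ∀ z ∈ R, ¬ E x y → ¬ E z y → x = z) : HasEightCycle E := by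
  classical
  let r : Fin 4 ≃ R := (R.equivFinOfCardEq hR).symm
  have hf : ∀ i, ∃ y, (∃ z ∈ C, ¬ E (r i) z) → y ∈ C ∧ ¬ E (r i) y := by
    intro i
    by_cases h : ∃ z ∈ C, ¬ E (r i) z
    · obtain ⟨z, hz⟩ := h
      exact ⟨z, fun _ => hz⟩
    · obtain ⟨y, -⟩ := Finset.card_pos.1 (show 0 < C.card by omega)
      exact ⟨y, fun h' => absurd h' h⟩
  choose f hf using hf
  obtain ⟨g, hg⟩ := Finset.exists_equiv_extend_of_card_eq (f := f) (t := C)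
    (s := Finset.univ.filter fun i => ∃ z ∈ C, ¬ E (r i) z) (by simp [hC])
    (by
      intro y hy
      obtain ⟨i, hi, rfl⟩ := Finset.mem_image.1 hy
      exact (hf i (Finset.mem_filter.1 hi).2).1)
    (by
      intro i hi j hj hij
      have hfi := hf i (Finset.mem_filter.1 hi).2
      have hfj := hf j (Finset.mem_filter.1 hj).2
      rw [← hij] at hfj
      exact r.injective (Subtype.ext (hcol _ hfi.1 _ (r i).2 _ (r j).2 hfi.2 hfj.2)))
  have key : ∀ i j, j ≠ i → E (r i) (g j) := by
    intro i j hij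
    by_contra h
    have hi : ∃ z ∈ C, ¬ E (r i) z := ⟨_, (g j).2, h⟩
    have hgi := hg i (Finset.mem_filter.2 ⟨Finset.mem_univ i, hi⟩)
    refine hij (g.injective (Subtype.ext ?_))
    rw [hgi]
    exact hrow _ (r i).2 _ (g j).2 _ (hf i hi).1 h (hf i hi).2
  refine ⟨fun i => r i, fun i => g (i + 1), Subtype.val_injective.comp r.injective,
    Subtype.val_injective.comp (g.injective.comp (add_left_injective 1)), fun i => ⟨?_, ?_⟩⟩
  · exact key _ _ (by revert i; decide)
  · exact key _ _ (by revert i; decide)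

/-- If every row misses at most one entry in a set of four columns, and some column of the set misses
two entries and has two others, then there is a cycle of length `8`. -/
theorem hasEightCycle_of_balanced_column {α β : Type*} [DecidableEq β] {E : α → β → Prop}
    {R : Finset α} {C : Finset β} (hC : C.card = 4)
    (h : ∀ x ∈ R, ∀ y ∈ C, ∀ z ∈ C, ¬ E x y → ¬ E x z → y = z) {y : β} (hy : y ∈ C)
    {a b c d : α} (ha : a ∈ R) (hb : b ∈ R) (hc : c ∈ R) (hd : d ∈ R) (hab : a ≠ b) (hcd : c ≠ d)
    (hay : ¬ E a y) (hby : ¬ E b y) (hcy : E c y) (hdy : E d y) : HasEightCycle E := by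
  have key : ∀ u ∈ C.erase y, ∀ v ∈ C.erase y, ∀ w ∈ C.erase y, u ≠ v → u ≠ w → v ≠ w →
      E c u → E d w → HasEightCycle E := by
    intro u hu v hv w hw huv huw hvw hcu hdw
    simp only [Finset.mem_erase] at hu hv hw
    have hac : a ≠ c := by rintro rfl; exact hay hcy
    have had : a ≠ d := by rintro rfl; exact hay hdy
    have hbc : b ≠ c := by rintro rfl; exact hby hcy
    have hbd : b ≠ d := by rintro rfl; exact hby hdy
    have hat : ∀ z ∈ C, z ≠ y → E a z := fun z hz hzy => by
      by_contra hza
      exact hzy (h a ha z hz y hy hza hay)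
    have hbt : ∀ z ∈ C, z ≠ y → E b z := fun z hz hzy => by
      by_contra hzb
      exact hzy (h b hb z hz y hy hzb hby)
    refine ⟨![c, a, b, d], ![y, u, v, w], ?_, ?_, ?_⟩
    · intro i j
      fin_cases i <;> fin_cases j <;> simp <;> grind
    · intro i j
      fin_cases i <;> fin_cases j <;> simp <;> grind
    · intro i
      fin_cases i <;> simp <;> grind
  obtain ⟨p, q, s, hpq, hps, hqs, hpqs⟩ := Finset.card_eq_three.1
    (show (C.erase y).card = 3 by rw [Finset.card_erase_of_mem hy, hC])
  have hp : p ∈ C.erase y := by simp [hpqs]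
  have hq : q ∈ C.erase y := by simp [hpqs]
  have hs : s ∈ C.erase y := by simp [hpqs]
  have hC' : ∀ z ∈ C.erase y, z ∈ C := fun z => Finset.mem_of_mem_erase
  have hcpq := h c hc p (hC' p hp) q (hC' q hq)
  have hdps := h d hd p (hC' p hp) s (hC' s hs)
  have hdqs := h d hd q (hC' q hq) s (hC' s hs)
  by_cases hcp : E c p
  · by_cases hdq : E d q
    · exact key p hp s hs q hq hps hpq hqs.symm hcp hdq
    · exact key p hp q hq s hs hpq hps hqs hcp (by_contra fun hds => hqs (hdqs hdq hds))
  · have hcq : E c q := by_contra fun hcq => hpq (hcpq hcp hcq)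
    by_cases hdp : E d p
    · exact key q hq s hs p hp hqs hpq.symm hps.symm hcq hdp
    · exact key q hq p hp s hs hpq.symm hqs hps hcq (by_contra fun hds => hps (hdps hdp hds))

/-- In a `5 × 4` block in which every row misses at most one entry and which contains no cycle of
length `8`, some column misses at least four entries. -/
theorem exists_sparse_column {α β : Type*} {E : α → β → Prop} (hE : ¬ HasEightCycle E)
    {R : Finset α} {C : Finset β} (hR : R.card = 5) (hC : C.card = 4)
    (h : ∀ x ∈ R, ∀ y ∈ C, ∀ z ∈ C, ¬ E x y → ¬ E x z → y = z) :
    ∃ y ∈ C, ∃ S ⊆ R, S.card = 4 ∧ ∀ x ∈ S, ¬ E x y := by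
  classical
  by_cases hcol : ∀ y ∈ C, ∀ x ∈ R, ∀ z ∈ R, ¬ E x y → ¬ E z y → x = z
  · obtain ⟨R', hR', hcard⟩ := Finset.exists_subset_card_eq (show 4 ≤ R.card by omega)
    exact absurd (hasEightCycle_of_missing_matching hcard hC (fun x hx => h x (hR' hx))
      fun y hy x hx z hz => hcol y hy x (hR' hx) z (hR' hz)) hE
  · push Not at hcol
    obtain ⟨y, hy, a, ha, b, hb, hay, hby, hab⟩ := hcol
    have hle : (R.filter fun x => E x y).card ≤ 1 := by
      by_contra! hlt
      obtain ⟨c, hc, d, hd, hcd⟩ := Finset.one_lt_card.1 hlt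
      rw [Finset.mem_filter] at hc hd
      exact hE (hasEightCycle_of_balanced_column hC h hy ha hb hc.1 hd.1 hab hcd hay hby hc.2 hd.2)
    have hsum := Finset.card_filter_add_card_filter_not (s := R) fun x => E x y
    obtain ⟨S, hS, hcard⟩ := Finset.exists_subset_card_eq
      (show 4 ≤ (R.filter fun x => ¬ E x y).card by omega)
    exact ⟨y, hy, S, hS.trans (Finset.filter_subset _ _), hcard,
      fun x hx => (Finset.mem_filter.1 (hS hx)).2⟩

/-- A complete `3 × 4` block in an `8 × 8` relation forces a cycle of length `8` in the relation or
in its complement. -/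
theorem hasEightCycle_or_compl {α β : Type*} [Fintype α] [Fintype β] [DecidableEq α]
    [DecidableEq β] (hα : Fintype.card α = 8) (hβ : Fintype.card β = 8) {E : α → β → Prop}
    {A : Finset α} {B : Finset β} (hA : A.card = 3) (hB : B.card = 4)
    (hAB : ∀ a ∈ A, ∀ b ∈ B, E a b) :
    HasEightCycle E ∨ HasEightCycle fun x y => ¬ E x y := by
  by_contra! hcon
  obtain ⟨hE, hF⟩ := hcon
  have hrow : ∀ x ∉ A, ∀ y ∈ B, ∀ z ∈ B, E x y → E x z → y = z := by
    intro x hx y hy z hz hxy hxz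
    by_contra hyz
    exact hE (hasEightCycle_of_block hA hB.ge hAB hx hy hz hyz hxy hxz)
  obtain ⟨b, hb, S, hSA, hS, hSb⟩ := exists_sparse_column hF (R := Aᶜ) (C := B)
    (by rw [Finset.card_compl, hα, hA]) hB
    (fun x hx y hy z hz hxy hxz => hrow x (Finset.mem_compl.1 hx) y hy z hz
      (not_not.1 hxy) (not_not.1 hxz))
  simp only [not_not] at hSb
  have hSA' : ∀ x ∈ S, x ∉ A := fun x hx => Finset.mem_compl.1 (hSA hx)
  have hBb : (B.erase b).card = 3 := by rw [Finset.card_erase_of_mem hb, hB]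
  have hblock : ∀ y ∈ B.erase b, ∀ x ∈ S, ¬ E x y := fun y hy x hx hxy =>
    (Finset.mem_erase.1 hy).1
      (hrow x (hSA' x hx) y (Finset.mem_erase.1 hy).2 b hb hxy (hSb x hx))
  have hcol : ∀ y ∉ B.erase b, ∀ x ∈ S, ∀ z ∈ S, ¬ E x y → ¬ E z y → x = z := by
    intro y hy x hx z hz hxy hzy
    by_contra hxz
    exact hF (HasEightCycle.of_flip
      (hasEightCycle_of_block hBb hS.ge hblock hy hx hz hxz hxy hzy))
  obtain ⟨s, hs, T, hTB, hT, hTs⟩ := exists_sparse_column (E := fun y x => E x y)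
    (fun h => hE h.of_flip) (R := (B.erase b)ᶜ) (C := S)
    (by rw [Finset.card_compl, hβ, hBb]) hS
    (fun y hy => hcol y (Finset.mem_compl.1 hy))
  have hTb : b ∉ T := fun hbT => hTs b hbT (hSb s hs)
  have hST : ∀ x ∈ S.erase s, ∀ y ∈ insert b T, E x y := by
    intro x hx y hy
    obtain ⟨hxs, hxS⟩ := Finset.mem_erase.1 hx
    obtain rfl | hyT := Finset.mem_insert.1 hy
    · exact hSb x hxS
    · by_contra hxy
      exact hxs (hcol y (Finset.mem_compl.1 (hTB hyT)) x hxS s hs hxy (hTs y hyT))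
  have hAT : ∀ x ∈ A, ∀ y ∈ T, ¬ E x y := by
    intro x hx y hy hxy
    refine hE (hasEightCycle_of_block (R := S.erase s) (C := insert b T) ?_ ?_ hST (x := x)
      (fun hxS => hSA' x (Finset.mem_of_mem_erase hxS) hx) (Finset.mem_insert_self b T)
      (Finset.mem_insert_of_mem hy) (by rintro rfl; exact hTb hy) (hAB x hx b hb) hxy)
    · rw [Finset.card_erase_of_mem hs, hS]
    · rw [Finset.card_insert_of_notMem hTb, hT]
      omega
  obtain ⟨y, hy, z, hz, hyz⟩ := Finset.one_lt_card.1 (show 1 < T.card by omega)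
  exact hF (hasEightCycle_of_block hA hT.ge hAT (hSA' s hs) hy hz hyz (hTs y hy) (hTs z hz))

theorem HasEightCycle.hasCycleLen {α β : Type*} {G : SimpleGraph (α ⊕ β)}
    (h : HasEightCycle fun x y => G.Adj (inl x) (inr y)) : HasCycleLen G 8 := by
  obtain ⟨r, c, hr, hc, h⟩ := h
  have h₀ := h 0
  have h₁ := h 1
  have h₂ := h 2
  have h₃ := h 3
  refine ⟨inl (r 0), .cons h₀.2 (.cons h₁.1.symm (.cons h₁.2 (.cons h₂.1.symm (.cons h₂.2
    (.cons h₃.1.symm (.cons h₃.2 (.cons h₀.1.symm .nil))))))), ?_, rfl⟩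
  rw [Walk.cons_isCycle_iff]
  simp [Walk.cons_isPath_iff, hr.eq_iff, hc.eq_iff]

/-- Proposition 1: if `G ⊆ K_{8,8}` contains a copy of `K_{3,4}` (size-3 part on one
side, size-4 part on the other), then `C_8 ⊆ G` or `C_8 ⊆ complement of G`. -/
theorem stmt4 (G : SimpleGraph (Fin 8 ⊕ Fin 8)) (hG : G ≤ Kbb 8)
    (A B : Finset (Fin 8)) (hA : A.card = 3) (hB : B.card = 4)
    (hAB : ∀ a ∈ A, ∀ b ∈ B, G.Adj (inl a) (inr b)) :
    HasCycleLen G 8 ∨ HasCycleLen (Kbb 8 \ G) 8 := by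
  refine (hasEightCycle_or_compl (by simp) (by simp) (E := fun x y => G.Adj (inl x) (inr y))
    hA hB hAB).imp (fun h => h.hasCycleLen) (fun h => HasEightCycle.hasCycleLen ?_)
  simpa using h
end

section
/- For all integers m, n ≥ 2, the bipartite Ramsey number satisfies BR(C_{2m}, C_{2n}) ≥ m+n−1. Equivalently, there exists a subgraph G of K_{m+n−2,m+n−2} such that G contains no cycle of length 2m and the bipartite complement of G in K_{m+n−2,m+n−2} contains no cycle of length 2n. -/
open SimpleGraph Sum

/-- A subgraph of `K_{b,b}` all of whose edges meet the left part inside `S` has no cycle of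
length greater than `2 * #S`. -/
theorem HasCycleLen.le_card_of_left_mem {b k : ℕ} {G : SimpleGraph (Fin b ⊕ Fin b)}
    (hG : G ≤ Kbb b) (S : Finset (Fin b)) (hS : ∀ i v, G.Adj (inl i) v → i ∈ S)
    (h : HasCycleLen G (2 * k)) : k ≤ S.card := by
  obtain ⟨v, w, hw, hlen⟩ := h
  have key : ∀ j : Fin k, ∃ i ∈ S, ∃ a, a / 2 = (j : ℕ) ∧ w.getVert a = inl i := by
    intro j
    have hadj : G.Adj (w.getVert (2 * j)) (w.getVert (2 * j + 1)) :=
      w.adj_getVert_succ (by omega)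
    have hK := hG hadj
    rcases hx : w.getVert (2 * j) with x | x
    · exact ⟨x, hS x _ (hx ▸ hadj), 2 * j, by omega, hx⟩
    · rcases hy : w.getVert (2 * j + 1) with y | y
      · exact ⟨y, hS y _ (hy ▸ hadj.symm), 2 * j + 1, by omega, hy⟩
      · simp [hx, hy] at hK
  choose f hfS a ha hfa using key
  have hinj : Function.Injective f := by
    intro j₁ j₂ hj
    have h₁ := ha j₁
    have h₂ := ha j₂
    have hab : a j₁ = a j₂ :=
      hw.getVert_injOn' (by simp only [Set.mem_ofPred_eq]; omega)
        (by simp only [Set.mem_ofPred_eq]; omega) (by rw [hfa, hfa, hj])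
    exact Fin.ext (by omega)
  simpa using Finset.card_le_card_of_injOn (s := Finset.univ) f (fun j _ => hfS j) hinj.injOn

/-- If `b ≤ m + n - 2`, joining `m - 1` left vertices to the whole right part gives a subgraph of
`K_{b,b}` without `C_{2m}` whose bipartite complement has no `C_{2n}`. -/
theorem exists_no_cycleLen {m n b : ℕ} (hm : 2 ≤ m) (hn : 2 ≤ n) (hb : b ≤ m + n - 2) :
    ∃ G : SimpleGraph (Fin b ⊕ Fin b), G ≤ Kbb b ∧
      ¬ HasCycleLen G (2 * m) ∧ ¬ HasCycleLen (Kbb b \ G) (2 * n) := by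
  let S : Finset (Fin b) := Finset.univ.filter fun i => (i : ℕ) < m - 1
  have hSle : S.card ≤ m - 1 := by
    simpa using Finset.card_le_card_of_injOn (s := S) (t := Finset.range (m - 1))
      (fun i : Fin b => (i : ℕ)) (fun i hi => by simpa [S] using hi) Fin.val_injective.injOn
  have hScle : Sᶜ.card ≤ n - 1 := by
    have := Finset.card_le_card_of_injOn (s := Sᶜ) (t := Finset.Ico (m - 1) b)
      (fun i : Fin b => (i : ℕ)) (fun i hi => by simpa [S] using hi) Fin.val_injective.injOn
    rw [Nat.card_Ico] at this
    omega
  let G : SimpleGraph (Fin b ⊕ Fin b) :=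
    { Adj := fun u v => (Kbb b).Adj u v ∧ ∃ i ∈ S, u = inl i ∨ v = inl i
      symm := ⟨fun u v ⟨h, i, hi, h'⟩ => ⟨h.symm, i, hi, h'.symm⟩⟩
      loopless := ⟨fun u h => (Kbb b).loopless.irrefl u h.1⟩ }
  have hGK : G ≤ Kbb b := fun {u v} (h : G.Adj u v) => h.1
  refine ⟨G, hGK, fun h => ?_, fun h => ?_⟩
  · have := h.le_card_of_left_mem hGK S (by
      rintro i v ⟨hK, j, hj, h | h⟩
      · rwa [inl.inj h]
      · simp [h] at hK)
    omega
  · have := h.le_card_of_left_mem sdiff_le Sᶜ (by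
      rintro i v ⟨hK, hnot⟩
      rw [Finset.mem_compl]
      exact fun hi => hnot ⟨hK, i, hi, Or.inl rfl⟩)
    omega

/-- Theorem 4: `BR(C_{2m}, C_{2n}) ≥ m + n - 1` for all `m, n ≥ 2`; equivalently there
is a subgraph `G` of `K_{m+n-2,m+n-2}` with no `C_{2m}` in `G` and no `C_{2n}` in its
bipartite complement. -/
theorem stmt5 (m n : ℕ) (hm : 2 ≤ m) (hn : 2 ≤ n) :
    (∀ b : ℕ, 0 < b → BRprop (2 * m) (2 * n) b → m + n - 1 ≤ b) ∧
    ∃ G : SimpleGraph (Fin (m + n - 2) ⊕ Fin (m + n - 2)), G ≤ Kbb (m + n - 2) ∧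
      ¬ HasCycleLen G (2 * m) ∧ ¬ HasCycleLen (Kbb (m + n - 2) \ G) (2 * n) := by
  refine ⟨fun b _ hB => ?_, exists_no_cycleLen hm hn le_rfl⟩
  by_contra hlt
  obtain ⟨G, hG, hGm, hGn⟩ := exists_no_cycleLen (b := b) hm hn (by omega)
  exact (hB G hG).elim hGm hGn
end

section
/- The bipartite Ramsey number BR(C_8, C_4) equals 5. -/
open SimpleGraph Sum

lemma hasCycleLen_four {V : Type*} {G : SimpleGraph V} {a b c d : V} (hab : G.Adj a b)
    (hbc : G.Adj b c) (hcd : G.Adj c d) (hda : G.Adj d a) (hac : a ≠ c) (hbd : b ≠ d) :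
    HasCycleLen G 4 := by
  refine ⟨a, .cons hab (.cons hbc (.cons hcd (.cons hda .nil))), ?_, rfl⟩
  have h1 := hab.ne
  have h2 := hbc.ne
  have h3 := hcd.ne
  have h4 := hda.ne
  rw [Walk.cons_isCycle_iff, Walk.isPath_def]
  constructor
  · simp; grind
  · simp; grind

/-- An 8-cycle in a bipartite graph, from alternating vertices of the two parts. -/
lemma hasCycleLen_eight {α β : Type*} {G : SimpleGraph (α ⊕ β)} {a b c d : α} {p q r s : β}
    (hrows : [a, b, c, d].Nodup) (hcols : [p, q, r, s].Nodup)
    (hap : G.Adj (inl a) (inr p)) (hbp : G.Adj (inl b) (inr p))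
    (hbq : G.Adj (inl b) (inr q)) (hcq : G.Adj (inl c) (inr q))
    (hcr : G.Adj (inl c) (inr r)) (hdr : G.Adj (inl d) (inr r))
    (hds : G.Adj (inl d) (inr s)) (has : G.Adj (inl a) (inr s)) :
    HasCycleLen G 8 := by
  refine ⟨inl a, .cons hap (.cons hbp.symm (.cons hbq (.cons hcq.symm (.cons hcr
    (.cons hdr.symm (.cons hds (.cons has.symm .nil))))))), ?_, rfl⟩
  rw [Walk.cons_isCycle_iff, Walk.isPath_def]
  simp only [List.nodup_cons, List.mem_cons, List.not_mem_nil, not_or] at hrows hcols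
  constructor
  · simp; grind
  · simp; grind

/-- The subgraph of `G` in which the vertex `v` has been isolated. -/
def isolate {V : Type*} (G : SimpleGraph V) (v : V) : SimpleGraph V where
  Adj x y := G.Adj x y ∧ x ≠ v ∧ y ≠ v
  symm := ⟨fun _ _ h => ⟨h.1.symm, h.2.2, h.2.1⟩⟩
  loopless := ⟨fun _ h => h.1.ne rfl⟩

lemma notMem_support_of_isolate {V : Type*} {G : SimpleGraph V} {v x y : V}
    (w : (isolate G v).Walk x y) (hy : y ≠ v) : v ∉ w.support := by
  induction w with
  | nil => simpa using hy.symm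
  | cons h p ih => simpa using ⟨h.2.1.symm, ih hy⟩

/-- An isolated vertex is missed by every cycle. -/
lemma length_lt_card_of_isolate {V : Type*} [Fintype V] {G : SimpleGraph V} {v : V} {m : ℕ}
    (h : HasCycleLen (isolate G v) m) : m < Fintype.card V := by
  obtain ⟨x, w, hw, rfl⟩ := h
  have hx : x ≠ v := by
    cases w with
    | nil => exact absurd rfl hw.ne_nil
    | cons h p => exact h.2.1
  have hv : v ∉ w.support.tail := fun h => notMem_support_of_isolate w hx (List.mem_of_mem_tail h)
  have hnd : (v :: w.support.tail).Nodup := List.nodup_cons.2 ⟨hv, hw.support_nodup⟩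
  simpa using hnd.length_le_card

lemma not_hasCycleLen_four_of_star {V : Type*} {G : SimpleGraph V} {v : V}
    (hG : ∀ x y, G.Adj x y → x = v ∨ y = v) : ¬ HasCycleLen G 4 := by
  rintro ⟨a, w, hw, hl⟩
  have hnd := hw.support_nodup
  rcases w with _ | ⟨h1, _ | ⟨h2, _ | ⟨h3, _ | ⟨h4, _ | ⟨h5, p⟩⟩⟩⟩⟩ <;> simp at hl
  have e1 := hG _ _ h1
  have e3 := hG _ _ h3
  simp at hnd
  grind

lemma not_BRprop_of_lt_five {b : ℕ} (hb : 0 < b) (hb5 : b < 5) : ¬ BRprop 8 4 b := by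
  intro h
  rcases h (isolate (Kbb b) (inl ⟨0, hb⟩)) (fun _ _ h => h.1) with h | h
  · have := length_lt_card_of_isolate h
    simp at this
    omega
  · refine not_hasCycleLen_four_of_star (v := inl ⟨0, hb⟩) (fun x y hxy => ?_) h
    by_contra! hne
    exact hxy.2 ⟨hxy.1, hne⟩

/-- The bit masks `x` and `y` share at most one bit. -/
def almostDisjoint (x y : ℕ) : Bool := ((x &&& y) &&& ((x &&& y) - 1)) == 0

/-- The masks of non-neighbours `x`, `y` leave column `j` as a common neighbour. -/
def commonCol (x y j : ℕ) : Bool := !(x ||| y).testBit j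

/-- Four rows, given by their masks of non-neighbours, lie in this cyclic order on an 8-cycle. -/
def cyclicRows (a b c d : ℕ) : Bool :=
  [0, 1, 2, 3, 4].any fun p => commonCol a b p &&
    [0, 1, 2, 3, 4].any fun q => (commonCol b c q && p != q) &&
      [0, 1, 2, 3, 4].any fun r => (commonCol c d r && (p != r && q != r)) &&
        [0, 1, 2, 3, 4].any fun s => commonCol d a s && (p != s && (q != s && r != s))

/-- Four rows, given by their masks of non-neighbours, lie on an 8-cycle. -/
def onEightCycle (a b c d : ℕ) : Bool :=
  cyclicRows a b c d || (cyclicRows a b d c || cyclicRows a c b d)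

/-- Every nondecreasing quintuple of pairwise almost disjoint masks has four members
on an 8-cycle. -/
def quintuplesHaveCycle : Bool :=
  (List.range 32).all fun a =>
  (List.range 32).all fun b => !(Nat.ble a b && almostDisjoint a b) ||
  (List.range 32).all fun c => !(Nat.ble b c && (almostDisjoint a c && almostDisjoint b c)) ||
  (List.range 32).all fun d =>
    !(Nat.ble c d && (almostDisjoint a d && (almostDisjoint b d && almostDisjoint c d))) ||
    (onEightCycle a b c d ||
  (List.range 32).all fun e =>
    !(Nat.ble d e && (almostDisjoint a e && (almostDisjoint b e &&
      (almostDisjoint c e && almostDisjoint d e)))) ||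
    (onEightCycle a b c e || (onEightCycle a b d e || (onEightCycle a c d e ||
      onEightCycle b c d e))))

set_option maxRecDepth 100000 in
lemma quintuplesHaveCycle_eq_true : quintuplesHaveCycle = true := by decide +kernel

set_option maxRecDepth 100000 in
lemma exists_common_bits_of_not_almostDisjoint :
    ∀ x y : Fin 32, almostDisjoint x y = false → ∃ j k : Fin 5, j ≠ k ∧
      x.val.testBit j = true ∧ x.val.testBit k = true ∧
      y.val.testBit j = true ∧ y.val.testBit k = true := by
  decide +kernel

lemma exists_mask :
    ∀ p : Fin 5 → Bool, ∃ m < 32, ∀ j : Fin 5, m.testBit j = p j := by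
  decide +kernel

lemma exists_cols_of_cyclicRows {a b c d : ℕ} (h : cyclicRows a b c d = true) :
    ∃ p q r s : Fin 5, [p, q, r, s].Nodup ∧ commonCol a b p = true ∧ commonCol b c q = true ∧
      commonCol c d r = true ∧ commonCol d a s = true := by
  have key : ∀ j ∈ [0, 1, 2, 3, 4], j < 5 := by decide
  simp only [cyclicRows, List.any_eq_true, Bool.and_eq_true, bne_iff_ne] at h
  obtain ⟨p, hp, h1, q, hq, ⟨h2, h3⟩, r, hr, ⟨h4, h5, h6⟩, s, hs, h7, h8, h9, h10⟩ := h
  refine ⟨⟨p, key p hp⟩, ⟨q, key q hq⟩, ⟨r, key r hr⟩, ⟨s, key s hs⟩, ?_, h1, h2, h4, h7⟩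
  simp [h3, h5, h6, h8, h9, h10]

lemma BRprop_five : BRprop 8 4 5 := by
  classical
  intro G hG
  by_contra! hcon
  obtain ⟨h8, h4⟩ := hcon
  choose f hf hfb using fun i : Fin 5 =>
    exists_mask fun j => decide (¬ G.Adj (inl i) (inr j))
  obtain ⟨σ, hσ⟩ : ∃ σ : Equiv.Perm (Fin 5), Monotone (f ∘ σ) := ⟨_, Tuple.monotone_sort f⟩
  have hdisj : ∀ i i', i ≠ i' → almostDisjoint (f (σ i)) (f (σ i')) = true := by
    intro i i' hne
    by_contra hfalse
    obtain ⟨j, k, hjk, h1, h2, h3, h5⟩ := exists_common_bits_of_not_almostDisjoint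
      ⟨_, hf (σ i)⟩ ⟨_, hf (σ i')⟩ (by simpa using hfalse)
    simp only [hfb, decide_eq_true_eq] at h1 h2 h3 h5
    refine h4 (hasCycleLen_four (a := inl (σ i)) (b := inr j) (c := inl (σ i')) (d := inr k)
      ⟨by simp, h1⟩ ⟨by simp, fun h => h3 h.symm⟩ ⟨by simp, h5⟩ ⟨by simp, fun h => h2 h.symm⟩
      ?_ ?_)
    · simpa using hne
    · simpa using hjk
  have hcol : ∀ i i' (j : Fin 5), commonCol (f i) (f i') j = true →
      G.Adj (inl i) (inr j) ∧ G.Adj (inl i') (inr j) := by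
    intro i i' j h
    simpa [commonCol, Nat.testBit_or, hfb] using h
  have hcyc : ∀ i₁ i₂ i₃ i₄, [i₁, i₂, i₃, i₄].Nodup →
      cyclicRows (f (σ i₁)) (f (σ i₂)) (f (σ i₃)) (f (σ i₄)) = false := by
    intro i₁ i₂ i₃ i₄ hnd
    by_contra htrue
    obtain ⟨p, q, r, s, hcols, hp, hq, hr, hs⟩ :=
      exists_cols_of_cyclicRows (by simpa using htrue)
    exact h8 (hasCycleLen_eight (hnd.map σ.injective) hcols (hcol _ _ _ hp).1 (hcol _ _ _ hp).2
      (hcol _ _ _ hq).1 (hcol _ _ _ hq).2 (hcol _ _ _ hr).1 (hcol _ _ _ hr).2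
      (hcol _ _ _ hs).1 (hcol _ _ _ hs).2)
  have hon : ∀ i₁ i₂ i₃ i₄, [i₁, i₂, i₃, i₄].Nodup →
      onEightCycle (f (σ i₁)) (f (σ i₂)) (f (σ i₃)) (f (σ i₄)) = false := by
    intro i₁ i₂ i₃ i₄ hnd
    simp only [onEightCycle, Bool.or_eq_false_iff]
    refine ⟨hcyc _ _ _ _ hnd, hcyc _ _ _ _ ?_, hcyc _ _ _ _ ?_⟩ <;>
    · simp at hnd ⊢
      grind
  have hle : ∀ i i', i ≤ i' → Nat.ble (f (σ i)) (f (σ i')) = true :=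
    fun i i' h => Nat.ble_eq_true_of_le (hσ h)
  have hall := quintuplesHaveCycle_eq_true
  simp only [quintuplesHaveCycle, List.all_eq_true, List.mem_range, Bool.or_eq_true,
    Bool.not_eq_true', Bool.and_eq_false_iff] at hall
  have h0 := hall _ (hf (σ 0)) _ (hf (σ 1))
  simp only [hle 0 1 (by decide), hdisj 0 1 (by decide), Bool.true_eq_false, or_self,
    false_or] at h0
  replace h0 := h0 _ (hf (σ 2))
  simp only [hle 1 2 (by decide), hdisj 0 2 (by decide), hdisj 1 2 (by decide),
    Bool.true_eq_false, or_self, false_or] at h0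
  replace h0 := h0 _ (hf (σ 3))
  simp only [hle 2 3 (by decide), hdisj 0 3 (by decide), hdisj 1 3 (by decide),
    hdisj 2 3 (by decide), hon 0 1 2 3 (by decide), Bool.true_eq_false, Bool.false_eq_true,
    or_self, false_or] at h0
  replace h0 := h0 _ (hf (σ 4))
  simp [hle 3 4 (by decide), hdisj 0 4 (by decide), hdisj 1 4 (by decide),
    hdisj 2 4 (by decide), hdisj 3 4 (by decide), hon 0 1 2 4 (by decide),
    hon 0 1 3 4 (by decide), hon 0 2 3 4 (by decide), hon 1 2 3 4 (by decide)] at h0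

/-- Lemma 3: `BR(C_8, C_4) = 5`. -/
theorem stmt8 : IsLeast {b : ℕ | 0 < b ∧ BRprop 8 4 b} 5 := by
  refine ⟨⟨by norm_num, BRprop_five⟩, fun b hb => ?_⟩
  by_contra! hlt
  exact not_BRprop_of_lt_five hb.1 hlt hb.2
end

section
/- The bipartite Ramsey number BR(C_8, C_6) equals 6. -/
open SimpleGraph Sum

/-! ### Alternating cycles of a relation -/

/-- A cycle of length `2 * n` in the bipartite graph of the relation `R`: it visits the rows
`r 0, r 1, …` and the columns `c 0, c 1, …` alternately. -/
def HasAltCycle {α β : Type*} (n : ℕ) [NeZero n] (R : α → β → Prop) : Prop :=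
  ∃ (r : Fin n → α) (c : Fin n → β), Function.Injective r ∧ Function.Injective c ∧
    ∀ t, R (r t) (c t) ∧ R (r (t + 1)) (c t)

theorem HasAltCycle.of_comp_equiv {α β : Type*} {n : ℕ} [NeZero n] {R : α → β → Prop}
    (σ : Equiv.Perm β) (h : HasAltCycle n fun i j => R i (σ j)) : HasAltCycle n R := by
  obtain ⟨r, c, hr, hc, h⟩ := h
  exact ⟨r, σ ∘ c, hr, σ.injective.comp hc, h⟩

theorem HasAltCycle.hasCycleLen_six {α β : Type*} {G : SimpleGraph (α ⊕ β)}
    (h : HasAltCycle 3 fun i j => G.Adj (inl i) (inr j)) : HasCycleLen G 6 := by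
  obtain ⟨r, c, hr, hc, h⟩ := h
  have h0 := h 0
  have h1 := h 1
  have h2 := h 2
  simp only [Fin.reduceAdd, zero_add] at h0 h1 h2
  refine ⟨inl (r 0), .cons h0.1 (.cons h0.2.symm (.cons h1.1 (.cons h1.2.symm
    (.cons h2.1 (.cons h2.2.symm .nil))))), ?_, rfl⟩
  rw [Walk.cons_isCycle_iff]
  simp [Walk.cons_isPath_iff, hr.eq_iff, hc.eq_iff]

theorem HasAltCycle.hasCycleLen_eight {α β : Type*} {G : SimpleGraph (α ⊕ β)}
    (h : HasAltCycle 4 fun i j => G.Adj (inl i) (inr j)) : HasCycleLen G 8 := by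
  obtain ⟨r, c, hr, hc, h⟩ := h
  have h0 := h 0
  have h1 := h 1
  have h2 := h 2
  have h3 := h 3
  simp only [Fin.reduceAdd, zero_add] at h0 h1 h2 h3
  refine ⟨inl (r 0), .cons h0.1 (.cons h0.2.symm (.cons h1.1 (.cons h1.2.symm
    (.cons h2.1 (.cons h2.2.symm (.cons h3.1 (.cons h3.2.symm .nil))))))), ?_, rfl⟩
  rw [Walk.cons_isCycle_iff]
  simp [Walk.cons_isPath_iff, hr.eq_iff, hc.eq_iff]

/-! ### Sets of columns as bit masks, and Hall's condition on them -/

/-- The subset of `Fin 6` encoded by the binary digits of `w`. -/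
def bits (w : ℕ) : Finset (Fin 6) := {j | w.testBit j}

theorem mem_bits {w : ℕ} {j : Fin 6} : j ∈ bits w ↔ w.testBit j := by simp [bits]

theorem bits_lor (v w : ℕ) : bits (Nat.lor v w) = bits v ∪ bits w := by
  ext j
  simp [mem_bits]

/-- Clear the lowest binary digit `1` of `w`. -/
def clearLow (w : ℕ) : ℕ := Nat.land w (Nat.sub w 1)

/-- `w` has at least one binary digit `1`. -/
def hasOne (w : ℕ) : Bool := Nat.ble 1 w

/-- `w` has at least two binary digits `1`. -/
def hasTwo (w : ℕ) : Bool := Nat.ble 1 (clearLow w)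

/-- `w` has at least three binary digits `1`. -/
def hasThree (w : ℕ) : Bool := Nat.ble 1 (clearLow (clearLow w))

/-- `w` has at least four binary digits `1`. -/
def hasFour (w : ℕ) : Bool := Nat.ble 1 (clearLow (clearLow (clearLow w)))

theorem one_le_card_bits {w : ℕ} (hw : w < 64) (h : hasOne w) : 1 ≤ (bits w).card := by
  revert w
  decide +kernel

theorem two_le_card_bits {w : ℕ} (hw : w < 64) (h : hasTwo w) : 2 ≤ (bits w).card := by
  revert w
  decide +kernel

theorem three_le_card_bits {w : ℕ} (hw : w < 64) (h : hasThree w) : 3 ≤ (bits w).card := by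
  revert w
  decide +kernel

theorem four_le_card_bits {w : ℕ} (hw : w < 64) (h : hasFour w) : 4 ≤ (bits w).card := by
  revert w
  decide +kernel

theorem land_lt_64 {v w : ℕ} (hv : v < 64) : Nat.land v w < 64 :=
  Nat.and_le_left.trans_lt hv

theorem lor_lt_64 {v w : ℕ} (hv : v < 64) (hw : w < 64) : Nat.lor v w < 64 :=
  Nat.or_lt_two_pow (n := 6) hv hw

theorem xor_lt_64 {v w : ℕ} (hv : v < 64) (hw : w < 64) : Nat.xor v w < 64 :=
  Nat.xor_lt_two_pow (n := 6) hv hw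

/-- Hall's condition for three sets given by bit masks. -/
def hallThree (a b c : ℕ) : Bool :=
  hasOne a && hasOne b && hasOne c &&
  hasTwo (Nat.lor a b) && hasTwo (Nat.lor b c) && hasTwo (Nat.lor a c) &&
  hasThree (Nat.lor a (Nat.lor b c))

/-- Hall's condition for four sets given by bit masks. -/
def hallFour (a b c d : ℕ) : Bool :=
  hasOne a && hasOne b && hasOne c && hasOne d &&
  hasTwo (Nat.lor a b) && hasTwo (Nat.lor b c) && hasTwo (Nat.lor a c) &&
  hasTwo (Nat.lor a d) && hasTwo (Nat.lor b d) && hasTwo (Nat.lor c d) &&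
  hasThree (Nat.lor a (Nat.lor b c)) && hasThree (Nat.lor a (Nat.lor b d)) &&
  hasThree (Nat.lor a (Nat.lor c d)) && hasThree (Nat.lor b (Nat.lor c d)) &&
  hasFour (Nat.lor a (Nat.lor b (Nat.lor c d)))

theorem exists_injective_of_hallThree {s : Fin 3 → ℕ} (hs : ∀ t, s t < 64)
    (h : hallThree (s 0) (s 1) (s 2)) :
    ∃ f : Fin 3 → Fin 6, Function.Injective f ∧ ∀ t, (s t).testBit (f t) := by
  simp only [hallThree, Bool.and_eq_true, and_assoc] at h
  obtain ⟨h0, h1, h2, h01, h12, h02, h012⟩ := h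
  have g0 := one_le_card_bits (hs 0) h0
  have g1 := one_le_card_bits (hs 1) h1
  have g2 := one_le_card_bits (hs 2) h2
  have g01 := two_le_card_bits (lor_lt_64 (hs 0) (hs 1)) h01
  have g12 := two_le_card_bits (lor_lt_64 (hs 1) (hs 2)) h12
  have g02 := two_le_card_bits (lor_lt_64 (hs 0) (hs 2)) h02
  have g012 := three_le_card_bits (lor_lt_64 (hs 0) (lor_lt_64 (hs 1) (hs 2))) h012
  simp only [bits_lor] at g01 g12 g02 g012
  have key : ∀ A : Finset (Fin 3), A = ∅ ∨ A = {0} ∨ A = {1} ∨ A = {2} ∨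
      A = {0, 1} ∨ A = {1, 2} ∨ A = {0, 2} ∨ A = {0, 1, 2} := by decide
  obtain ⟨f, hf, hft⟩ := (Finset.all_card_le_biUnion_card_iff_exists_injective
    fun t => bits (s t)).1 fun A => by
      obtain rfl | rfl | rfl | rfl | rfl | rfl | rfl | rfl := key A <;>
        simp only [Finset.biUnion_insert, Finset.singleton_biUnion, Finset.card_empty, zero_le]
      all_goals assumption
  exact ⟨f, hf, fun t => mem_bits.1 (hft t)⟩

theorem exists_injective_of_hallFour {s : Fin 4 → ℕ} (hs : ∀ t, s t < 64)
    (h : hallFour (s 0) (s 1) (s 2) (s 3)) :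
    ∃ f : Fin 4 → Fin 6, Function.Injective f ∧ ∀ t, (s t).testBit (f t) := by
  simp only [hallFour, Bool.and_eq_true, and_assoc] at h
  obtain ⟨h0, h1, h2, h3, h01, h12, h02, h03, h13, h23, h012, h013, h023, h123, h0123⟩ := h
  have g0 := one_le_card_bits (hs 0) h0
  have g1 := one_le_card_bits (hs 1) h1
  have g2 := one_le_card_bits (hs 2) h2
  have g3 := one_le_card_bits (hs 3) h3
  have g01 := two_le_card_bits (lor_lt_64 (hs 0) (hs 1)) h01
  have g12 := two_le_card_bits (lor_lt_64 (hs 1) (hs 2)) h12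
  have g02 := two_le_card_bits (lor_lt_64 (hs 0) (hs 2)) h02
  have g03 := two_le_card_bits (lor_lt_64 (hs 0) (hs 3)) h03
  have g13 := two_le_card_bits (lor_lt_64 (hs 1) (hs 3)) h13
  have g23 := two_le_card_bits (lor_lt_64 (hs 2) (hs 3)) h23
  have g012 := three_le_card_bits (lor_lt_64 (hs 0) (lor_lt_64 (hs 1) (hs 2))) h012
  have g013 := three_le_card_bits (lor_lt_64 (hs 0) (lor_lt_64 (hs 1) (hs 3))) h013
  have g023 := three_le_card_bits (lor_lt_64 (hs 0) (lor_lt_64 (hs 2) (hs 3))) h023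
  have g123 := three_le_card_bits (lor_lt_64 (hs 1) (lor_lt_64 (hs 2) (hs 3))) h123
  have g0123 := four_le_card_bits
    (lor_lt_64 (hs 0) (lor_lt_64 (hs 1) (lor_lt_64 (hs 2) (hs 3)))) h0123
  simp only [bits_lor] at g01 g12 g02 g03 g13 g23 g012 g013 g023 g123 g0123
  have key : ∀ A : Finset (Fin 4), A = ∅ ∨ A = {0} ∨ A = {1} ∨ A = {2} ∨ A = {3} ∨
      A = {0, 1} ∨ A = {1, 2} ∨ A = {0, 2} ∨ A = {0, 3} ∨ A = {1, 3} ∨ A = {2, 3} ∨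
      A = {0, 1, 2} ∨ A = {0, 1, 3} ∨ A = {0, 2, 3} ∨ A = {1, 2, 3} ∨ A = {0, 1, 2, 3} := by
    decide +kernel
  obtain ⟨f, hf, hft⟩ := (Finset.all_card_le_biUnion_card_iff_exists_injective
    fun t => bits (s t)).1 fun A => by
      obtain rfl | rfl | rfl | rfl | rfl | rfl | rfl | rfl | rfl | rfl | rfl | rfl | rfl | rfl |
          rfl | rfl := key A <;>
        simp only [Finset.biUnion_insert, Finset.singleton_biUnion, Finset.card_empty, zero_le]
      all_goals assumption
  exact ⟨f, hf, fun t => mem_bits.1 (hft t)⟩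

/-! ### The exhaustive search -/

/-- The rows `a`, `b`, `c` (in this cyclic order) lie on a hexagon of non-edges. -/
def blueHexagon (a b c : ℕ) : Bool :=
  hallThree (Nat.xor 63 (Nat.lor a b)) (Nat.xor 63 (Nat.lor b c)) (Nat.xor 63 (Nat.lor c a))

/-- The rows `a`, `b`, `c`, `d` (in this cyclic order) lie on an octagon of edges. -/
def redOctagon (a b c d : ℕ) : Bool :=
  hallFour (Nat.land a b) (Nat.land b c) (Nat.land c d) (Nat.land d a)

/-- The relation between `ι` and `Fin 6` with rows `m` has an octagon, or its complement has a
hexagon. -/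
def Unavoidable {ι : Type*} (m : ι → ℕ) : Prop :=
  HasAltCycle 4 (fun i (j : Fin 6) => (m i).testBit j) ∨
    HasAltCycle 3 (fun i (j : Fin 6) => ¬ (m i).testBit j)

theorem unavoidable_of_blueHexagon {ι : Type*} {m : ι → ℕ} (hm : ∀ i, m i < 64) {a b c : ι}
    (hd : [a, b, c].Nodup) (h : blueHexagon (m a) (m b) (m c)) : Unavoidable m := by
  obtain ⟨f, hf, hft⟩ := exists_injective_of_hallThree
    (s := fun t => Nat.xor 63 (Nat.lor (m (![a, b, c] t)) (m (![a, b, c] (t + 1)))))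
    (fun t => xor_lt_64 (by decide) (lor_lt_64 (hm _) (hm _))) h
  refine Or.inr ⟨![a, b, c], f, List.nodup_ofFn.1 (by simpa using hd), hf, fun t => ?_⟩
  have h63 : ∀ j : Fin 6, Nat.testBit 63 j := by decide
  have := hft t
  change Nat.testBit (63 ^^^ (m _ ||| m _)) _ = true at this
  rw [Nat.testBit_xor, Nat.testBit_or, h63] at this
  simpa using this

theorem unavoidable_of_redOctagon {ι : Type*} {m : ι → ℕ} (hm : ∀ i, m i < 64) {a b c d : ι}
    (hd : [a, b, c, d].Nodup) (h : redOctagon (m a) (m b) (m c) (m d)) : Unavoidable m := by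
  obtain ⟨f, hf, hft⟩ := exists_injective_of_hallFour
    (s := fun t => Nat.land (m (![a, b, c, d] t)) (m (![a, b, c, d] (t + 1))))
    (fun t => land_lt_64 (hm _)) h
  refine Or.inl ⟨![a, b, c, d], f, List.nodup_ofFn.1 (by simpa using hd), hf, fun t => ?_⟩
  have := hft t
  change Nat.testBit (m _ &&& m _) _ = true at this
  simpa using this

/-- No two members of the list form an octagon of edges together with the rows `x` and `y`. -/
def noRedOctagon (x y : ℕ) : List ℕ → Bool
  | [] => true
  | p :: ps => (ps.all fun q =>
      !redOctagon x p q y && !redOctagon x q p y && !redOctagon x p y q) && noRedOctagon x y ps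

/-- No two members of `pre` form an octagon of edges together with the rows `x` and `y`, and no
member of `pre` forms a hexagon of non-edges together with `x` and `y`. -/
def compatible (x : ℕ) (pre : List ℕ) (y : ℕ) : Bool :=
  (pre.all fun p => !blueHexagon p x y) && noRedOctagon x y pre

/-- The rows `pre` cannot be extended by `n` further rows from the list `cs`. -/
def refutes : ℕ → List ℕ → List ℕ → Bool
  | 0, _, _ => false
  | n + 1, pre, cs => cs.tails.all fun
    | [] => true
    | x :: t => refutes n (x :: pre) ((x :: t).filter (compatible x pre))

theorem unavoidable_of_noRedOctagon_eq_false {ι : Type*} {m : ι → ℕ} (hm : ∀ i, m i < 64)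
    {x y : ι} {pre : List ι} (hd : (x :: y :: pre).Nodup)
    (h : noRedOctagon (m x) (m y) (pre.map m) = false) : Unavoidable m := by
  induction pre with
  | nil => simp [noRedOctagon] at h
  | cons p ps ih =>
    simp only [List.map_cons, noRedOctagon, Bool.and_eq_false_iff] at h
    rcases h with h | h
    · simp only [List.all_map, List.all_eq_false, Function.comp_apply, Bool.and_eq_true,
        Bool.not_eq_true', not_and_or, Bool.not_eq_false] at h
      obtain ⟨q, hq, h⟩ := h
      have hd' : [x, y, p, q].Nodup := by
        refine hd.sublist ?_
        simpa using hq
      rcases h with (h | h) | h <;> refine unavoidable_of_redOctagon hm ?_ h <;>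
        simp at hd' ⊢ <;> grind
    · exact ih (hd.sublist (by simp)) h

theorem unavoidable_of_compatible_eq_false {ι : Type*} {m : ι → ℕ} (hm : ∀ i, m i < 64)
    {x y : ι} {pre : List ι} (hd : (x :: y :: pre).Nodup)
    (h : compatible (m x) (pre.map m) (m y) = false) : Unavoidable m := by
  simp only [compatible, Bool.and_eq_false_iff] at h
  rcases h with h | h
  · simp only [List.all_map, List.all_eq_false, Function.comp_apply, Bool.not_eq_true',
      Bool.not_eq_false] at h
    obtain ⟨p, hp, h⟩ := h
    refine unavoidable_of_blueHexagon hm ?_ h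
    simp at hd ⊢
    grind
  · exact unavoidable_of_noRedOctagon_eq_false hm hd h

theorem unavoidable_of_refutes {ι : Type*} {m : ι → ℕ} (hm : ∀ i, m i < 64) (n : ℕ)
    (pre : List ι) (cs : List ℕ) (h : refutes n (pre.map m) cs) (l : List ι)
    (hl : l.length = n) (hd : (l ++ pre).Nodup) (hcs : ∀ i ∈ l, m i ∈ cs) : Unavoidable m := by
  classical
  induction n generalizing pre cs l with
  | zero => simp [refutes] at h
  | succ n ih =>
    induction cs with
    | nil =>
      obtain ⟨i, hi⟩ := List.exists_mem_of_length_eq_add_one hl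
      simpa using hcs i hi
    | cons x t iht =>
      simp only [refutes, List.tails_cons, List.all_cons, Bool.and_eq_true] at h
      by_cases hx : ∃ i ∈ l, m i = x
      · obtain ⟨i, hi, rfl⟩ := hx
        have hperm := List.perm_cons_erase hi
        have hd' : (i :: l.erase i ++ pre).Nodup :=
          (hperm.append_right pre).nodup_iff.1 hd
        by_cases hc : ∀ k ∈ l.erase i, compatible (m i) (pre.map m) (m k)
        · refine ih (i :: pre) _ h.1 (l.erase i) ?_ ?_ fun k hk => ?_
          · rw [List.length_erase_of_mem hi, hl, Nat.add_sub_cancel]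
          · exact List.perm_middle.nodup_iff.2 hd'
          · exact List.mem_filter.2 ⟨hcs k (List.mem_of_mem_erase hk), hc k hk⟩
        · push Not at hc
          obtain ⟨k, hk, hc⟩ := hc
          refine unavoidable_of_compatible_eq_false hm (hd'.sublist ?_) (by simpa using hc)
          refine List.Sublist.cons_cons i ?_
          exact (List.singleton_sublist.2 hk).append_right pre
      · refine iht (by simpa [refutes] using h.2) fun i hi => ?_
        have := hcs i hi
        rw [List.mem_cons] at this
        exact this.resolve_left fun hix => hx ⟨i, hi, hix⟩

/-- The order in which the search treats the possible sizes of a row. -/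
def sizeRank (d : ℕ) : ℕ := [6, 4, 2, 0, 1, 3, 5].getD d 0

/-- The rows whose sizes are not treated before `d`. -/
def candidates (d : ℕ) : List ℕ :=
  (List.range 64).filter fun m => sizeRank d ≤ sizeRank (bits m).card

theorem refutes_candidates : ∀ d < 7, refutes 5 [2 ^ d - 1] (candidates d) = true := by
  decide +kernel

theorem unavoidable_of_minimal_row {ι : Type*} {m : ι → ℕ} (hm : ∀ i, m i < 64) {i₀ : ι}
    {l : List ι} (hl : l.length = 5) (hd : (i₀ :: l).Nodup) {d : ℕ} (hd7 : d < 7)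
    (hi₀ : m i₀ = 2 ^ d - 1) (hmin : ∀ i, sizeRank d ≤ sizeRank (bits (m i)).card) :
    Unavoidable m := by
  refine unavoidable_of_refutes hm 5 [i₀] (candidates d) ?_ l hl ?_ fun i _ => ?_
  · simpa [hi₀] using refutes_candidates d hd7
  · exact (List.perm_append_singleton i₀ l).nodup_iff.2 hd
  · simpa [candidates, hm] using hmin i

theorem exists_perm_mem_iff_lt {n : ℕ} (s : Finset (Fin n)) :
    ∃ σ : Equiv.Perm (Fin n), ∀ j, σ j ∈ s ↔ (j : ℕ) < s.card := by
  have hs : s.card ≤ n := by simpa using s.card_le_univ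
  have hcard : Fintype.card {j : Fin n // (j : ℕ) < s.card} = Fintype.card {j // j ∈ s} := by
    rw [Fintype.card_coe, Fintype.card_subtype, Fin.card_filter_val_lt, min_eq_right hs]
  let e := Fintype.equivOfCardEq hcard
  refine ⟨e.extendSubtype, fun j => ⟨fun h => ?_, e.extendSubtype_mem j⟩⟩
  by_contra hj
  exact e.extendSubtype_not_mem j hj h

/-- Every relation between two sets of six elements has an octagon, or its complement has a
hexagon. -/
theorem hasAltCycle_four_or_compl_three (R : Fin 6 → Fin 6 → Prop) :
    HasAltCycle 4 R ∨ HasAltCycle 3 fun i j => ¬ R i j := by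
  classical
  let S (i : Fin 6) : Finset (Fin 6) := {j | R i j}
  obtain ⟨i₀, -, hi₀⟩ := Finset.exists_min_image Finset.univ (fun i => sizeRank (S i).card)
    Finset.univ_nonempty
  obtain ⟨σ, hσ⟩ := exists_perm_mem_iff_lt (S i₀)
  let m (i : Fin 6) : ℕ := Nat.ofBits fun j : Fin 6 => decide (R i (σ j))
  have hm (i) : m i < 64 := Nat.ofBits_lt_two_pow _
  have hbit (i j : Fin 6) : (m i).testBit j = decide (R i (σ j)) :=
    Nat.testBit_ofBits_lt _ _ j.isLt
  have hcard (i) : (bits (m i)).card = (S i).card := by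
    refine Finset.card_equiv σ fun j => ?_
    simp [mem_bits, hbit, S]
  have hd7 : (S i₀).card < 7 := Nat.lt_succ_of_le (by simpa using (S i₀).card_le_univ)
  have hm₀ : m i₀ = 2 ^ (S i₀).card - 1 := by
    refine Nat.eq_of_testBit_eq fun j => ?_
    rw [Nat.testBit_two_pow_sub_one]
    by_cases hj : j < 6
    · have := hσ ⟨j, hj⟩
      rw [show (m i₀).testBit j = _ from hbit i₀ ⟨j, hj⟩]
      simpa [S] using this
    · rw [show (m i₀).testBit j = false from Nat.testBit_ofBits_ge _ _ (by omega)]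
      symm
      simp
      omega
  have hu : Unavoidable m := by
    refine unavoidable_of_minimal_row hm (i₀ := i₀) (l := (Finset.univ.erase i₀).toList)
      ?_ ?_ hd7 hm₀ fun i => ?_
    · simp
    · simp [Finset.nodup_toList]
    · rw [hcard]
      exact hi₀ i (Finset.mem_univ i)
  simp only [Unavoidable, hbit, decide_eq_true_eq] at hu
  exact hu.imp (HasAltCycle.of_comp_equiv σ)
    (HasAltCycle.of_comp_equiv (R := fun i j => ¬ R i j) σ)

/-! ### The lower bound -/

/-- In a bipartite graph, a cycle of length `2 * m` has `m` vertices on the left. -/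
theorem le_card_of_hasCycleLen {α β : Type*} {G : SimpleGraph (α ⊕ β)}
    (hG : G ≤ completeBipartiteGraph α β) {m : ℕ} (h : HasCycleLen G (2 * m)) (s : Finset α)
    (hs : ∀ i j, G.Adj (inl i) (inr j) → i ∈ s) : m ≤ s.card := by
  classical
  obtain ⟨v, w, hw, hlen⟩ := h
  have hadj (k) (hk : k < 2 * m) : G.Adj (w.getVert k) (w.getVert (k + 1)) :=
    w.adj_getVert_succ (hlen ▸ hk)
  have hside (k) (hk : k < 2 * m) :
      (w.getVert (k + 1)).isLeft = !(w.getVert k).isLeft := by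
    have := hG (hadj k hk)
    rw [completeBipartiteGraph_adj] at this
    grind
  have halt (k) (hk : 2 * k ≤ 2 * m) : (w.getVert (2 * k)).isLeft = v.isLeft := by
    induction k with
    | zero => simp
    | succ k ih =>
      rw [show 2 * (k + 1) = 2 * k + 1 + 1 by ring, hside _ (by omega), hside _ (by omega),
        ih (by omega), Bool.not_not]
  obtain ⟨o, ho, hleft⟩ : ∃ o, (o = 1 ∨ o = 2) ∧
      ∀ k < m, (w.getVert (2 * k + o)).isLeft = true := by
    by_cases hv : v.isLeft
    · exact ⟨2, .inr rfl, fun k hk => (halt (k + 1) (by omega)).trans hv⟩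
    · refine ⟨1, .inl rfl, fun k hk => ?_⟩
      rw [hside _ (by omega), halt k (by omega)]
      simpa using hv
  have hmem (k) (hk : k < m) : w.getVert (2 * k + o) ∈ s.map .inl := by
    have hl := hleft k hk
    have ha : G.Adj (w.getVert (2 * k + o - 1)) (w.getVert (2 * k + o)) := by
      have := hadj (2 * k + o - 1) (by omega)
      rwa [Nat.sub_add_cancel (by omega)] at this
    cases hx : w.getVert (2 * k + o) with
    | inr j => simp [hx] at hl
    | inl i =>
      rw [hx] at ha
      cases hy : w.getVert (2 * k + o - 1) with
      | inl i' => simpa [hy] using hG ha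
      | inr j =>
        rw [hy] at ha
        simpa using hs i j ha.symm
  have := Finset.card_le_card_of_injOn (s := Finset.range m) (t := s.map .inl)
    (fun k => w.getVert (2 * k + o)) (fun k hk => hmem k (Finset.mem_range.1 hk))
    fun k hk k' hk' hkk => by
      have hk := Finset.mem_range.1 hk
      have hk' := Finset.mem_range.1 hk'
      have := hw.getVert_injOn (x₁ := 2 * k + o) (x₂ := 2 * k' + o)
        ⟨by omega, by omega⟩ ⟨by omega, by omega⟩ hkk
      omega
  simpa using this

theorem six_le_of_BRprop {b : ℕ} (h : BRprop 8 6 b) : 6 ≤ b := by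
  by_contra! hb
  let G : SimpleGraph (Fin b ⊕ Fin b) := Kbb b ⊓ SimpleGraph.fromRel fun x _ =>
    ∃ i : Fin b, x = inl i ∧ (i : ℕ) < 3
  have hG (i j : Fin b) : G.Adj (inl i) (inr j) ↔ (i : ℕ) < 3 := by simp [G]
  rcases h G inf_le_left with h | h
  · have := le_card_of_hasCycleLen (m := 4) inf_le_left h {i | (i : ℕ) < 3} fun i j hij => by
      simpa using (hG i j).1 hij
    rw [Fin.card_filter_val_lt] at this
    omega
  · have := le_card_of_hasCycleLen (m := 3) sdiff_le h {i | ¬ (i : ℕ) < 3} fun i j hij => by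
      simpa [hG] using hij
    have hc := Finset.card_filter_add_card_filter_not (s := (Finset.univ : Finset (Fin b)))
      (fun i => (i : ℕ) < 3)
    rw [Fin.card_filter_val_lt, Finset.card_univ, Fintype.card_fin] at hc
    omega

/-- Lemma 4: `BR(C_8, C_6) = 6`. -/
theorem stmt9 : IsLeast {b : ℕ | 0 < b ∧ BRprop 8 6 b} 6 := by
  refine ⟨⟨by norm_num, fun G _ => ?_⟩, fun b hb => six_le_of_BRprop hb.2⟩
  refine (hasAltCycle_four_or_compl_three fun i j => G.Adj (inl i) (inr j)).imp
    HasAltCycle.hasCycleLen_eight fun h => HasAltCycle.hasCycleLen_six ?_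
  simpa using h
end
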